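/- Let X, Y, Z : I → ℝ be twice-differentiable positive functions on an open interval I such that each of the products X·Y·Z·η_i (i = 1, 2, 3) is constant on I, and let E denote the constant value of −(1/2)X²Y²Z²(η₁² + η₂² + η₃²). Let φ : I → ℝ be twice differentiable and V : ℝ → ℝ be a function satisfying equations (3.12) and (3.13): φ̇(t)² = (2/(3K²))(−θ̇(t) + E/(X(t)²Y(t)²Z(t)²)) and V(φ(t)) = (1/(3K²))(θ(t)² + θ̇(t)) for all t ∈ I. Then (X, Y, Z, φ, V) solves the Bianchi I field equations (i)-(iv) on I. -/

import Mathlib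

/-- The derivative of a logarithmic derivative `f' / f`. -/
theorem hasDerivAt_deriv_div_self {f : ℝ → ℝ} {t : ℝ} (hf : DifferentiableAt ℝ f t)
    (hf' : DifferentiableAt ℝ (deriv f) t) (h0 : f t ≠ 0) :
    HasDerivAt (fun s => deriv f s / f s)
      (deriv (deriv f) t / f t - (deriv f t / f t) ^ 2) t := by
  refine (hf'.hasDerivAt.div hf.hasDerivAt h0).congr_deriv ?_
  field_simp

/-- If `X * Y * Z * η` is locally constant, then `η' = -θ η`, where `θ` is the logarithmic
derivative of `X * Y * Z`. -/
theorem deriv_eq_of_mul_eventually_const {X Y Z η : ℝ → ℝ} {t η' k : ℝ}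
    (hX : DifferentiableAt ℝ X t) (hY : DifferentiableAt ℝ Y t) (hZ : DifferentiableAt ℝ Z t)
    (hX0 : X t ≠ 0) (hY0 : Y t ≠ 0) (hZ0 : Z t ≠ 0) (hη : HasDerivAt η η' t)
    (hk : ∀ᶠ s in nhds t, X s * Y s * Z s * η s = k) :
    η' = -((deriv X t / X t + deriv Y t / Y t + deriv Z t / Z t) * η t) := by
  have hprod := ((hX.hasDerivAt.mul hY.hasDerivAt).mul hZ.hasDerivAt).mul hη
  have hzero := hprod.unique ((hasDerivAt_const t k).congr_of_eventuallyEq hk)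
  simp only [Pi.mul_apply] at hzero
  have hne : X t * Y t * Z t ≠ 0 := mul_ne_zero (mul_ne_zero hX0 hY0) hZ0
  apply mul_left_cancel₀ hne
  field_simp
  linear_combination hzero

/-- Remark 2: given `X, Y, Z` with constant products `X·Y·Z·ηᵢ`, if `φ` and `V` satisfy
equations (3.12) and (3.13) (with the constant `E` determined by `X, Y, Z`), then
`(X, Y, Z, φ, V)` solves the Bianchi I field equations (i)-(iv). -/
theorem stmt_15 (K a b : ℝ) (hK : 0 < K) (X Y Z φ : ℝ → ℝ) (V : ℝ → ℝ)
    (hX1 : ∀ t ∈ Set.Ioo a b, DifferentiableAt ℝ X t)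
    (hX2 : ∀ t ∈ Set.Ioo a b, DifferentiableAt ℝ (deriv X) t)
    (hY1 : ∀ t ∈ Set.Ioo a b, DifferentiableAt ℝ Y t)
    (hY2 : ∀ t ∈ Set.Ioo a b, DifferentiableAt ℝ (deriv Y) t)
    (hZ1 : ∀ t ∈ Set.Ioo a b, DifferentiableAt ℝ Z t)
    (hZ2 : ∀ t ∈ Set.Ioo a b, DifferentiableAt ℝ (deriv Z) t)
    (hφ1 : ∀ t ∈ Set.Ioo a b, DifferentiableAt ℝ φ t)
    (hφ2 : ∀ t ∈ Set.Ioo a b, DifferentiableAt ℝ (deriv φ) t)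
    (hXpos : ∀ t ∈ Set.Ioo a b, 0 < X t)
    (hYpos : ∀ t ∈ Set.Ioo a b, 0 < Y t)
    (hZpos : ∀ t ∈ Set.Ioo a b, 0 < Z t)
    (θ : ℝ → ℝ)
    (hθ : ∀ t ∈ Set.Ioo a b, θ t = deriv X t / X t + deriv Y t / Y t + deriv Z t / Z t)
    (η₁ η₂ η₃ : ℝ → ℝ)
    (hη₁ : ∀ t ∈ Set.Ioo a b, η₁ t = deriv X t / X t - deriv Y t / Y t)
    (hη₂ : ∀ t ∈ Set.Ioo a b, η₂ t = deriv X t / X t - deriv Z t / Z t)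
    (hη₃ : ∀ t ∈ Set.Ioo a b, η₃ t = deriv Y t / Y t - deriv Z t / Z t)
    (hk₁ : ∃ k : ℝ, ∀ t ∈ Set.Ioo a b, X t * Y t * Z t * η₁ t = k)
    (hk₂ : ∃ k : ℝ, ∀ t ∈ Set.Ioo a b, X t * Y t * Z t * η₂ t = k)
    (hk₃ : ∃ k : ℝ, ∀ t ∈ Set.Ioo a b, X t * Y t * Z t * η₃ t = k)
    (E : ℝ)
    (hEdef : ∀ t ∈ Set.Ioo a b,
      -(1 / 2) * (X t ^ 2 * Y t ^ 2 * Z t ^ 2 * (η₁ t ^ 2 + η₂ t ^ 2 + η₃ t ^ 2)) = E)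
    (h312 : ∀ t ∈ Set.Ioo a b,
      (deriv φ t) ^ 2 = 2 / (3 * K ^ 2) * (-(deriv θ t) + E / (X t ^ 2 * Y t ^ 2 * Z t ^ 2)))
    (h313 : ∀ t ∈ Set.Ioo a b, V (φ t) = 1 / (3 * K ^ 2) * (θ t ^ 2 + deriv θ t))
    (ρ p : ℝ → ℝ)
    (hρ : ∀ t, ρ t = (deriv φ t) ^ 2 / 2 + V (φ t))
    (hp : ∀ t, p t = (deriv φ t) ^ 2 / 2 - V (φ t))
    :
    ∀ t ∈ Set.Ioo a b,
      ((deriv X t / X t) * (deriv Y t / Y t) + (deriv X t / X t) * (deriv Z t / Z t) + (deriv Y t / Y t) * (deriv Z t / Z t) = K ^ 2 * ρ t) ∧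
      (deriv (deriv X) t / X t + deriv (deriv Y) t / Y t + (deriv X t / X t) * (deriv Y t / Y t) = -(K ^ 2 * p t)) ∧
      (deriv (deriv X) t / X t + deriv (deriv Z) t / Z t + (deriv X t / X t) * (deriv Z t / Z t) = -(K ^ 2 * p t)) ∧
      (deriv (deriv Y) t / Y t + deriv (deriv Z) t / Z t + (deriv Y t / Y t) * (deriv Z t / Z t) = -(K ^ 2 * p t)) := by
  intro t ht
  have hX0 := (hXpos t ht).ne'
  have hY0 := (hYpos t ht).ne'
  have hZ0 := (hZpos t ht).ne'
  have hI : ∀ᶠ s in nhds t, s ∈ Set.Ioo a b := isOpen_Ioo.mem_nhds ht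
  have dX := hasDerivAt_deriv_div_self (hX1 t ht) (hX2 t ht) hX0
  have dY := hasDerivAt_deriv_div_self (hY1 t ht) (hY2 t ht) hY0
  have dZ := hasDerivAt_deriv_div_self (hZ1 t ht) (hZ2 t ht) hZ0
  have hθ' := (((dX.add dY).add dZ).congr_of_eventuallyEq (hI.mono hθ)).deriv
  obtain ⟨k₁, hk₁⟩ := hk₁
  obtain ⟨k₂, hk₂⟩ := hk₂
  have e₁ := deriv_eq_of_mul_eventually_const (hX1 t ht) (hY1 t ht) (hZ1 t ht) hX0 hY0 hZ0
    ((dX.sub dY).congr_of_eventuallyEq (hI.mono hη₁)) (hI.mono hk₁)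
  have e₂ := deriv_eq_of_mul_eventually_const (hX1 t ht) (hY1 t ht) (hZ1 t ht) hX0 hY0 hZ0
    ((dX.sub dZ).congr_of_eventuallyEq (hI.mono hη₂)) (hI.mono hk₂)
  have hE : E / (X t ^ 2 * Y t ^ 2 * Z t ^ 2) =
      -(1 / 2) * (η₁ t ^ 2 + η₂ t ^ 2 + η₃ t ^ 2) := by
    rw [← hEdef t ht]
    field_simp
  have hφ : K ^ 2 * deriv φ t ^ 2 =
      2 / 3 * (-deriv θ t - 1 / 2 * (η₁ t ^ 2 + η₂ t ^ 2 + η₃ t ^ 2)) := by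
    rw [h312 t ht, hE]
    field_simp
    ring
  have hV : K ^ 2 * V (φ t) = 1 / 3 * (θ t ^ 2 + deriv θ t) := by
    rw [h313 t ht]
    field_simp
  rw [hθ', hη₁ t ht, hη₂ t ht, hη₃ t ht] at hφ
  rw [hθ', hθ t ht] at hV
  rw [hη₁ t ht] at e₁
  rw [hη₂ t ht] at e₂
  rw [hρ, hp]
  generalize deriv (deriv X) t / X t = A at *
  generalize deriv (deriv Y) t / Y t = B at *
  generalize deriv (deriv Z) t / Z t = C at *
  generalize deriv X t / X t = x at *
  generalize deriv Y t / Y t = y at *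
  generalize deriv Z t / Z t = z at *
  refine ⟨?_, ?_, ?_, ?_⟩
  · linear_combination -hφ / 2 - hV
  · linear_combination hφ / 2 - hV - e₁ / 3 + 2 * e₂ / 3
  · linear_combination hφ / 2 - hV - e₂ / 3 + 2 * e₁ / 3
  · linear_combination hφ / 2 - hV - e₂ / 3 - e₁ / 3
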